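/- arXiv:math/0301168 — 7 statements merged into one kernel-verified Lean document; each statement's English description precedes it below -/
import Mathlib

section
/- For vectors q, p, q', p' in ℝ³, there exists a matrix g in SO(3) with g·q = q' and g·p = p' if and only if ⟨q,q⟩ = ⟨q',q'⟩, ⟨p,p⟩ = ⟨p',p'⟩, and ⟨q,p⟩ = ⟨q',p'⟩. (In other words, the map F₁(q,p) = (|q|², |p|², ⟨q,p⟩) separates the orbits of the diagonal SO(3)-action on ℝ³ × ℝ³.) -/
open Matrix

section Householder

variable {n : Type*} [Fintype n] [DecidableEq n]

/-- The reflection in the hyperplane orthogonal to `v` (the identity when `v = 0`). -/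
noncomputable def householder (v : n → ℝ) : Matrix n n ℝ :=
  1 - (2 / (v ⬝ᵥ v)) • vecMulVec v v

lemma householder_mulVec (v x : n → ℝ) :
    householder v *ᵥ x = x - (2 / (v ⬝ᵥ v) * (v ⬝ᵥ x)) • v := by
  ext i
  simp [householder, sub_mulVec, smul_mulVec, vecMulVec_mulVec]
  ring

lemma householder_mulVec_of_dotProduct_eq_zero {v x : n → ℝ} (h : v ⬝ᵥ x = 0) :
    householder v *ᵥ x = x := by
  simp [householder_mulVec, h]

lemma householder_sub_mulVec {x y : n → ℝ} (h : x ⬝ᵥ x = y ⬝ᵥ y) :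
    householder (x - y) *ᵥ x = y := by
  by_cases hv : (x - y) ⬝ᵥ (x - y) = 0
  · rw [dotProduct_self_eq_zero, sub_eq_zero] at hv
    simp [householder_mulVec, hv]
  · have key : (x - y) ⬝ᵥ (x - y) = 2 * ((x - y) ⬝ᵥ x) := by
      simp only [sub_dotProduct, dotProduct_sub, dotProduct_comm y x]
      linarith
    have hc : 2 / ((x - y) ⬝ᵥ (x - y)) * ((x - y) ⬝ᵥ x) = 1 := by
      rw [div_mul_eq_mul_div, ← key, div_self hv]
    rw [householder_mulVec, hc, one_smul, sub_sub_cancel]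

lemma householder_transpose_mul_self (v : n → ℝ) :
    (householder v)ᵀ * householder v = 1 := by
  have ht : (householder v)ᵀ = householder v := by
    simp [householder, transpose_vecMulVec]
  rw [ht]
  by_cases hv : v ⬝ᵥ v = 0
  · simp [householder, hv]
  · have hsq : vecMulVec v v * vecMulVec v v = (v ⬝ᵥ v) • vecMulVec v v := by
      ext i j
      simp [vecMulVec_mul_vecMulVec, vecMulVec_apply]
      ring
    simp only [householder, sub_mul, mul_sub, one_mul, mul_one, smul_mul_assoc, mul_smul_comm,
      hsq, smul_smul, div_mul_cancel₀ _ hv]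
    module

lemma det_householder {v : n → ℝ} (hv : v ≠ 0) : (householder v).det = -1 := by
  have hv' : v ⬝ᵥ v ≠ 0 := by rwa [Ne, dotProduct_self_eq_zero]
  have h : householder v = 1 + vecMulVec (-(2 / (v ⬝ᵥ v)) • v) v := by
    rw [householder, smul_vecMulVec, neg_smul, sub_eq_add_neg]
  rw [h, vecMulVec_eq Unit, det_one_add_replicateCol_mul_replicateRow, dotProduct_smul, smul_eq_mul]
  field_simp
  norm_num

lemma mulVec_dotProduct_mulVec {g : Matrix n n ℝ} (hg : gᵀ * g = 1) (x y : n → ℝ) :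
    (g *ᵥ x) ⬝ᵥ (g *ᵥ y) = x ⬝ᵥ y := by
  rw [dotProduct_mulVec, ← mulVec_transpose, mulVec_mulVec, hg, one_mulVec]

lemma transpose_mul_self_mul {g h : Matrix n n ℝ} (hg : gᵀ * g = 1) (hh : hᵀ * h = 1) :
    (g * h)ᵀ * (g * h) = 1 := by
  rw [transpose_mul, Matrix.mul_assoc, ← Matrix.mul_assoc gᵀ, hg, Matrix.one_mul, hh]

end Householder

lemma exists_ne_zero_dotProduct_pair_eq_zero (x y : Fin 3 → ℝ) :
    ∃ v : Fin 3 → ℝ, v ≠ 0 ∧ v ⬝ᵥ x = 0 ∧ v ⬝ᵥ y = 0 := by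
  have hdet : (Matrix.of ![x, y, 0]).det = 0 := det_eq_zero_of_row_eq_zero 2 (by simp)
  obtain ⟨v, hv, h⟩ := exists_mulVec_eq_zero_iff.mpr hdet
  refine ⟨v, hv, ?_, ?_⟩
  · rw [dotProduct_comm]; exact congrFun h 0
  · rw [dotProduct_comm]; exact congrFun h 1

/-- For vectors `q, p, q', p'` in `ℝ³`, there exists `g ∈ SO(3)` with
`g·q = q'` and `g·p = p'` iff `⟨q,q⟩ = ⟨q',q'⟩`, `⟨p,p⟩ = ⟨p',p'⟩` and `⟨q,p⟩ = ⟨q',p'⟩`. -/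
theorem so3_orbit_iff_invariants (q p q' p' : Fin 3 → ℝ) :
    (∃ g : Matrix (Fin 3) (Fin 3) ℝ, gᵀ * g = 1 ∧ g.det = 1 ∧
      g.mulVec q = q' ∧ g.mulVec p = p') ↔
    (q ⬝ᵥ q = q' ⬝ᵥ q' ∧ p ⬝ᵥ p = p' ⬝ᵥ p' ∧ q ⬝ᵥ p = q' ⬝ᵥ p') := by
  constructor
  · rintro ⟨g, hg, -, rfl, rfl⟩
    simp only [mulVec_dotProduct_mulVec hg, and_self]
  · rintro ⟨hqq, hpp, hqp⟩
    obtain ⟨g, hg, hgq, hgp⟩ : ∃ g : Matrix (Fin 3) (Fin 3) ℝ,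
        gᵀ * g = 1 ∧ g *ᵥ q = q' ∧ g *ᵥ p = p' := by
      have hr := householder_transpose_mul_self (q - q')
      have hrq := householder_sub_mulVec hqq
      set r := householder (q - q')
      have hperp : (r *ᵥ p - p') ⬝ᵥ q' = 0 := by
        rw [sub_dotProduct, dotProduct_comm p', ← hqp, dotProduct_comm, ← hrq,
          mulVec_dotProduct_mulVec hr, sub_self]
      refine ⟨householder (r *ᵥ p - p') * r,
        transpose_mul_self_mul (householder_transpose_mul_self _) hr, ?_, ?_⟩
      · rw [← mulVec_mulVec, hrq, householder_mulVec_of_dotProduct_eq_zero hperp]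
      · rw [← mulVec_mulVec,
          householder_sub_mulVec ((mulVec_dotProduct_mulVec hr p p).trans hpp)]
    have hdet : g.det * g.det = 1 := by
      simpa only [det_mul, det_transpose, det_one] using congrArg det hg
    rcases mul_self_eq_one_iff.mp hdet with h | h
    · exact ⟨g, hg, h, hgq, hgp⟩
    · obtain ⟨v, hv, hvq, hvp⟩ := exists_ne_zero_dotProduct_pair_eq_zero q' p'
      refine ⟨householder v * g,
        transpose_mul_self_mul (householder_transpose_mul_self v) hg, ?_, ?_, ?_⟩
      · rw [det_mul, det_householder hv, h]
        norm_num
      · rw [← mulVec_mulVec, hgq, householder_mulVec_of_dotProduct_eq_zero hvq]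
      · rw [← mulVec_mulVec, hgp, householder_mulVec_of_dotProduct_eq_zero hvp]
end

section
/- The image of the map F₁ : ℝ³ × ℝ³ → ℝ³ given by F₁(q,p) = (|q|², |p|², ⟨q,p⟩) is exactly the solid cone C = {(α,β,γ) ∈ ℝ³ : α ≥ 0, β ≥ 0, αβ ≥ γ²}. -/
open Matrix

/-- The image of `F₁(q,p) = (|q|², |p|², ⟨q,p⟩)` is exactly the solid cone
`C = {(α,β,γ) : α ≥ 0, β ≥ 0, αβ ≥ γ²}`. -/
theorem range_F1_eq_cone :
    (Set.range fun x : (Fin 3 → ℝ) × (Fin 3 → ℝ) =>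
        ((x.1 ⬝ᵥ x.1, x.2 ⬝ᵥ x.2, x.1 ⬝ᵥ x.2) : ℝ × ℝ × ℝ)) =
      {y : ℝ × ℝ × ℝ | 0 ≤ y.1 ∧ 0 ≤ y.2.1 ∧ y.2.2 ^ 2 ≤ y.1 * y.2.1} := by
  ext ⟨a, b, c⟩
  simp only [Set.mem_range, Set.mem_ofPred_eq, Prod.mk.injEq, Prod.exists]
  constructor
  · rintro ⟨q, p, rfl, rfl, rfl⟩
    simp only [dotProduct, Fin.sum_univ_three]
    refine ⟨by nlinarith [sq_nonneg (q 0), sq_nonneg (q 1), sq_nonneg (q 2)],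
      by nlinarith [sq_nonneg (p 0), sq_nonneg (p 1), sq_nonneg (p 2)], ?_⟩
    nlinarith [sq_nonneg (q 0 * p 1 - q 1 * p 0), sq_nonneg (q 0 * p 2 - q 2 * p 0),
      sq_nonneg (q 1 * p 2 - q 2 * p 1)]
  · rintro ⟨ha, hb, hc⟩
    have hdiv : c ^ 2 / a ≤ b := div_le_of_le_mul₀ ha hb (by linarith)
    have hcancel : √a * (c / √a) = c := by
      rcases ha.eq_or_lt with rfl | ha
      · have : c = 0 := by nlinarith
        simp [this]
      · exact mul_div_cancel₀ c (Real.sqrt_pos.mpr ha).ne'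
    refine ⟨![√a, 0, 0], ![c / √a, √(b - c ^ 2 / a), 0], ?_, ?_, ?_⟩
    · simp [dotProduct, Fin.sum_univ_three, Real.mul_self_sqrt ha]
    · simp [dotProduct, Fin.sum_univ_three, ← sq, div_pow, Real.sq_sqrt ha,
        Real.sq_sqrt (sub_nonneg.mpr hdiv)]
    · simpa [dotProduct, Fin.sum_univ_three] using hcancel
end

section
/- The map F₁(q,p) = (|q|², |p|², ⟨q,p⟩) is constant on the orbits of the diagonal SO(3)-action on ℝ³ × ℝ³ and the induced map from the orbit space (ℝ³ × ℝ³)/SO(3) (with the quotient topology) to ℝ³ is a homeomorphism onto the solid cone C = {(α,β,γ) : α ≥ 0, β ≥ 0, αβ ≥ γ²} with its subspace topology. -/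
open Matrix

/-- The map `F₁(q,p) = (|q|², |p|², ⟨q,p⟩)`. -/
def F1 (x : (Fin 3 → ℝ) × (Fin 3 → ℝ)) : ℝ × ℝ × ℝ :=
  (x.1 ⬝ᵥ x.1, x.2 ⬝ᵥ x.2, x.1 ⬝ᵥ x.2)

/-- The solid cone `C = {(α,β,γ) : α ≥ 0, β ≥ 0, αβ ≥ γ²}`. -/
def solidCone : Set (ℝ × ℝ × ℝ) :=
  {y | 0 ≤ y.1 ∧ 0 ≤ y.2.1 ∧ y.2.2 ^ 2 ≤ y.1 * y.2.1}

/-- A vector of `ℝ³` is its length times a unit vector. -/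
lemma exists_unit_smul (v : Fin 3 → ℝ) :
    ∃ u : Fin 3 → ℝ, u ⬝ᵥ u = 1 ∧ v = √(v ⬝ᵥ v) • u := by
  by_cases hv : v = 0
  · exact ⟨![1, 0, 0], by simp, by simp [hv]⟩
  · have h0 : 0 < v ⬝ᵥ v := by
      refine lt_of_le_of_ne (by simpa using dotProduct_star_self_nonneg v) (Ne.symm ?_)
      rwa [Ne, dotProduct_self_eq_zero]
    have h1 : 0 < √(v ⬝ᵥ v) := Real.sqrt_pos.2 h0
    refine ⟨(√(v ⬝ᵥ v))⁻¹ • v, ?_, ?_⟩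
    · rw [smul_dotProduct, dotProduct_smul, smul_eq_mul, smul_eq_mul]
      field_simp
      rw [Real.sq_sqrt h0.le]
    · rw [smul_smul, mul_inv_cancel₀ h1.ne', one_smul]

/-- A vector of `ℝ³` orthogonal to `u` is its length times a unit vector
orthogonal to `u`. -/
lemma exists_unit_orthogonal_smul {u v : Fin 3 → ℝ} (huv : u ⬝ᵥ v = 0) :
    ∃ w : Fin 3 → ℝ, w ⬝ᵥ w = 1 ∧ u ⬝ᵥ w = 0 ∧ v = √(v ⬝ᵥ v) • w := by
  have key : ∀ v : Fin 3 → ℝ, v ≠ 0 → u ⬝ᵥ v = 0 →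
      ∃ w : Fin 3 → ℝ, w ⬝ᵥ w = 1 ∧ u ⬝ᵥ w = 0 ∧ v = √(v ⬝ᵥ v) • w := by
    intro v hv huv
    obtain ⟨w, hw, hvw⟩ := exists_unit_smul v
    refine ⟨w, hw, ?_, hvw⟩
    rw [hvw, dotProduct_smul, smul_eq_mul, mul_eq_zero] at huv
    refine huv.resolve_left fun h => hv ?_
    rw [hvw, h, zero_smul]
  by_cases hv : v = 0
  · obtain ⟨r, hr, hur⟩ : ∃ r : Fin 3 → ℝ, r ≠ 0 ∧ u ⬝ᵥ r = 0 := by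
      by_cases h : u 0 = 0 ∧ u 1 = 0
      · exact ⟨![1, 0, 0], fun h0 => by simpa using congrFun h0 0,
          by simp [dotProduct, Fin.sum_univ_three, h.1]⟩
      · refine ⟨![-u 1, u 0, 0], fun h0 => h ⟨by simpa using congrFun h0 1,
          by simpa using congrFun h0 0⟩, ?_⟩
        simp [dotProduct, Fin.sum_univ_three]
        ring
    obtain ⟨w, hw, huw, -⟩ := key r hr hur
    exact ⟨w, hw, huw, by simp [hv]⟩
  · exact key v hv huv

/-- Two orthonormal vectors of `ℝ³` are the first two rows of a rotation matrix. -/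
lemma exists_rotation_of_orthonormal {u w : Fin 3 → ℝ} (hu : u ⬝ᵥ u = 1) (hw : w ⬝ᵥ w = 1)
    (huw : u ⬝ᵥ w = 0) :
    ∃ g : Matrix (Fin 3) (Fin 3) ℝ, gᵀ * g = 1 ∧ g.det = 1 ∧
      g *ᵥ u = ![1, 0, 0] ∧ g *ᵥ w = ![0, 1, 0] := by
  have hcc : (u ⨯₃ w) ⬝ᵥ (u ⨯₃ w) = 1 := by
    rw [cross_dot_cross, hu, hw, huw, dotProduct_comm w u, huw]; norm_num
  have huc : u ⬝ᵥ (u ⨯₃ w) = 0 := dot_self_cross u w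
  have hwc : w ⬝ᵥ (u ⨯₃ w) = 0 := dot_cross_self u w
  have hwu : w ⬝ᵥ u = 0 := by rw [dotProduct_comm, huw]
  have hcu : (u ⨯₃ w) ⬝ᵥ u = 0 := by rw [dotProduct_comm, huc]
  have hcw : (u ⨯₃ w) ⬝ᵥ w = 0 := by rw [dotProduct_comm, hwc]
  refine ⟨Matrix.of ![u, w, u ⨯₃ w], ?_, ?_, ?_, ?_⟩
  · rw [mul_eq_one_comm]
    ext i j
    change (![u, w, u ⨯₃ w] i) ⬝ᵥ (![u, w, u ⨯₃ w] j) = _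
    fin_cases i <;> fin_cases j <;> simp [*]
  · refine (triple_product_eq_det u w (u ⨯₃ w)).symm.trans ?_
    rw [triple_product_permutation, triple_product_permutation, hcc]
  · ext i
    change (![u, w, u ⨯₃ w] i) ⬝ᵥ u = _
    fin_cases i <;> simp [*]
  · ext i
    change (![u, w, u ⨯₃ w] i) ⬝ᵥ w = _
    fin_cases i <;> simp [*]

/-- A representative of the orbit with invariants `y`. -/
noncomputable def orbitRep (y : ℝ × ℝ × ℝ) : (Fin 3 → ℝ) × (Fin 3 → ℝ) :=
  if y.1 = 0 then (0, ![√y.2.1, 0, 0])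
  else (![√y.1, 0, 0], ![y.2.2 / √y.1, √(y.2.1 - y.2.2 ^ 2 / y.1), 0])

lemma F1_orbitRep {y : ℝ × ℝ × ℝ} (hy : y ∈ solidCone) : F1 (orbitRep y) = y := by
  obtain ⟨α, β, γ⟩ := y
  obtain ⟨hα, hβ, hγ⟩ := hy
  simp only at hα hβ hγ
  by_cases h : α = 0
  · subst h
    have : γ = 0 := by nlinarith
    simp [F1, orbitRep, Real.mul_self_sqrt hβ, this]
  · have hα' : 0 < α := lt_of_le_of_ne hα (Ne.symm h)
    have hs : √α ≠ 0 := (Real.sqrt_pos.2 hα').ne'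
    have hc : 0 ≤ β - γ ^ 2 / α := by
      rw [sub_nonneg, div_le_iff₀ hα']; linarith
    simp only [F1, orbitRep, h, if_false, dotProduct, Fin.sum_univ_three, Prod.mk.injEq]
    simp only [cons_val_zero, cons_val_one, cons_val, Real.mul_self_sqrt hc,
      Real.mul_self_sqrt hα, mul_zero, zero_mul, add_zero, true_and]
    refine ⟨?_, by field_simp⟩
    rw [← sq, div_pow, Real.sq_sqrt hα]
    ring

lemma exists_rotation_orbitRep (x : (Fin 3 → ℝ) × (Fin 3 → ℝ)) :
    ∃ g : Matrix (Fin 3) (Fin 3) ℝ, gᵀ * g = 1 ∧ g.det = 1 ∧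
      g *ᵥ x.1 = (orbitRep (F1 x)).1 ∧ g *ᵥ x.2 = (orbitRep (F1 x)).2 := by
  obtain ⟨q, p⟩ := x
  by_cases hq : q = 0
  · subst hq
    obtain ⟨u, hu, hpu⟩ := exists_unit_smul p
    obtain ⟨w, hw, huw, -⟩ := exists_unit_orthogonal_smul (dotProduct_zero u)
    obtain ⟨g, hg, hd, hgu, -⟩ := exists_rotation_of_orthonormal hu hw huw
    refine ⟨g, hg, hd, by simp [F1, orbitRep], ?_⟩
    have : g *ᵥ p = √(p ⬝ᵥ p) • ![1, 0, 0] := by rw [← hgu, ← mulVec_smul, ← hpu]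
    simp [F1, orbitRep, this]
  · have hqq : q ⬝ᵥ q ≠ 0 := by rwa [Ne, dotProduct_self_eq_zero]
    have hqn : 0 ≤ q ⬝ᵥ q := by simpa using dotProduct_star_self_nonneg q
    obtain ⟨u, hu, hqu⟩ := exists_unit_smul q
    have hs : √(q ⬝ᵥ q) ≠ 0 := (Real.sqrt_pos.2 (lt_of_le_of_ne hqn hqq.symm)).ne'
    have hqp : q ⬝ᵥ p = √(q ⬝ᵥ q) * (u ⬝ᵥ p) := by
      conv_lhs => rw [hqu]
      rw [smul_dotProduct, smul_eq_mul]
    have hup : u ⬝ᵥ (p - (u ⬝ᵥ p) • u) = 0 := by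
      rw [dotProduct_sub, dotProduct_smul, hu]; simp
    obtain ⟨w, hw, huw, hpw⟩ := exists_unit_orthogonal_smul hup
    have hlen : (p - (u ⬝ᵥ p) • u) ⬝ᵥ (p - (u ⬝ᵥ p) • u)
        = p ⬝ᵥ p - (q ⬝ᵥ p) ^ 2 / (q ⬝ᵥ q) := by
      rw [hqp, mul_pow, Real.sq_sqrt hqn, mul_div_cancel_left₀ _ hqq]
      simp only [dotProduct_sub, sub_dotProduct, dotProduct_smul, smul_dotProduct, hu,
        dotProduct_comm p u, smul_eq_mul]
      ring
    rw [hlen] at hpw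
    obtain ⟨g, hg, hd, hgu, hgw⟩ := exists_rotation_of_orthonormal hu hw huw
    have h1 : g *ᵥ q = √(q ⬝ᵥ q) • ![1, 0, 0] := by rw [← hgu, ← mulVec_smul, ← hqu]
    have h2 : g *ᵥ p = (u ⬝ᵥ p) • ![1, 0, 0] +
        √(p ⬝ᵥ p - (q ⬝ᵥ p) ^ 2 / (q ⬝ᵥ q)) • ![0, 1, 0] := by
      rw [← hgu, ← hgw, ← mulVec_smul, ← mulVec_smul, ← mulVec_add, ← hpw,
        add_sub_cancel]
    have h3 : (q ⬝ᵥ p) / √(q ⬝ᵥ q) = u ⬝ᵥ p := by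
      rw [hqp, mul_div_cancel_left₀ _ hs]
    refine ⟨g, hg, hd, ?_, ?_⟩
    · simp [F1, orbitRep, hq, h1]
    · simp [F1, orbitRep, hq, h2, h3]

lemma F1_mem_solidCone (x : (Fin 3 → ℝ) × (Fin 3 → ℝ)) : F1 x ∈ solidCone := by
  refine ⟨by simpa [F1] using dotProduct_star_self_nonneg x.1,
    by simpa [F1] using dotProduct_star_self_nonneg x.2, ?_⟩
  simpa [F1, dotProduct, sq] using Finset.sum_mul_sq_le_sq_mul_sq Finset.univ x.1 x.2

lemma F1_mulVec {g : Matrix (Fin 3) (Fin 3) ℝ} (hg : gᵀ * g = 1)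
    (x : (Fin 3 → ℝ) × (Fin 3 → ℝ)) : F1 (g *ᵥ x.1, g *ᵥ x.2) = F1 x := by
  have h : ∀ v w : Fin 3 → ℝ, (g *ᵥ v) ⬝ᵥ (g *ᵥ w) = v ⬝ᵥ w := fun v w => by
    rw [dotProduct_mulVec, vecMul_mulVec, ← dotProduct_mulVec, hg, one_mulVec]
  simp [F1, h]

lemma continuous_F1 : Continuous F1 := by
  unfold F1; fun_prop

lemma isProperMap_F1 : IsProperMap F1 := by
  rw [isProperMap_iff_isCompact_preimage]
  refine ⟨continuous_F1, fun {K} hK => ?_⟩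
  refine Metric.isCompact_of_isClosed_isBounded (hK.isClosed.preimage continuous_F1) ?_
  obtain ⟨R, hR⟩ := hK.isBounded.exists_norm_le
  have hle : ∀ (v : Fin 3 → ℝ), v ⬝ᵥ v ≤ R → ‖v‖ ≤ √R := fun v hv => by
    refine (pi_norm_le_iff_of_nonneg (Real.sqrt_nonneg R)).2 fun i => Real.abs_le_sqrt ?_
    refine le_trans ?_ hv
    rw [sq]
    exact Finset.single_le_sum (f := fun i => v i * v i) (fun i _ => mul_self_nonneg (v i))
      (Finset.mem_univ i)
  refine isBounded_iff_forall_norm_le.2 ⟨√R, fun x hx => norm_prod_le_iff.2 ⟨hle _ ?_, hle _ ?_⟩⟩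
  · exact (le_abs_self _).trans ((norm_fst_le (F1 x)).trans (hR _ hx))
  · exact (le_abs_self _).trans
      ((norm_fst_le (F1 x).2).trans ((norm_snd_le (F1 x)).trans (hR _ hx)))

lemma isQuotientMap_codRestrict_F1 :
    Topology.IsQuotientMap (Set.codRestrict F1 solidCone F1_mem_solidCone) := by
  exact (isProperMap_F1.isClosedMap.codRestrict _).isQuotientMap (continuous_F1.codRestrict _)
    fun y => ⟨orbitRep y, Subtype.ext (F1_orbitRep y.2)⟩

/-- `F₁` is constant on the orbits of the diagonal `SO(3)`-action on `ℝ³ × ℝ³`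
and induces a homeomorphism from the orbit space (with the quotient topology) onto the solid
cone `C` (with the subspace topology). -/
theorem F1_descends_to_homeomorph_onto_cone
    (s : Setoid ((Fin 3 → ℝ) × (Fin 3 → ℝ)))
    (hs : ∀ x y, s.r x y ↔ ∃ g : Matrix (Fin 3) (Fin 3) ℝ,
      gᵀ * g = 1 ∧ g.det = 1 ∧ g.mulVec x.1 = y.1 ∧ g.mulVec x.2 = y.2) :
    (∀ x y, s.r x y → F1 x = F1 y) ∧
    ∃ h : Quotient s ≃ₜ solidCone,
      ∀ x : (Fin 3 → ℝ) × (Fin 3 → ℝ), (h (Quotient.mk s x) : ℝ × ℝ × ℝ) = F1 x := by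
  have hrel : ∀ x y, s.r x y ↔ F1 x = F1 y := by
    intro x y
    constructor
    · intro h
      obtain ⟨g, hg, -, h1, h2⟩ := (hs x y).1 h
      rw [← F1_mulVec hg x, h1, h2]
    · intro h
      have hx : s.r x (orbitRep (F1 x)) := (hs _ _).2 (exists_rotation_orbitRep x)
      have hy : s.r y (orbitRep (F1 y)) := (hs _ _).2 (exists_rotation_orbitRep y)
      rw [h] at hx
      exact s.trans hx (s.symm hy)
  refine ⟨fun x y => (hrel x y).1, ?_⟩
  obtain rfl : s = Setoid.ker (Set.codRestrict F1 solidCone F1_mem_solidCone) := by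
    ext x y
    rw [Setoid.ker_def, Subtype.ext_iff]
    exact hrel x y
  let f : C((Fin 3 → ℝ) × (Fin 3 → ℝ), solidCone) := ⟨_, continuous_F1.codRestrict F1_mem_solidCone⟩
  exact ⟨Topology.IsQuotientMap.homeomorph (f := f) isQuotientMap_codRestrict_F1, fun x => rfl⟩
end

section
/- Let ω be an ℝ-bilinear form on ℝ³ × ℝ³ (viewed as a real vector space of pairs (q,p)) that is alternating (ω(x, x) = 0 for all x) and invariant under the diagonal SO(3)-action, i.e. ω((g·q, g·p), (g·q', g·p')) = ω((q,p), (q',p')) for all g ∈ SO(3). Then there exists a real constant c such that ω((q,p), (q',p')) = c·(⟨q,p'⟩ − ⟨p,q'⟩) for all q, p, q', p' ∈ ℝ³. -/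
open Matrix

/-- Every `SO(3)`-invariant bilinear form on `ℝ³` is a multiple of the dot product. -/
theorem bilinear_eq_smul_dotProduct_of_so3_invariant
    (B : (Fin 3 → ℝ) →ₗ[ℝ] (Fin 3 → ℝ) →ₗ[ℝ] ℝ)
    (hB : ∀ g : Matrix (Fin 3) (Fin 3) ℝ, gᵀ * g = 1 → g.det = 1 →
      ∀ u v : Fin 3 → ℝ, B (g.mulVec u) (g.mulVec v) = B u v) :
    ∃ c : ℝ, ∀ u v : Fin 3 → ℝ, B u v = c * (u ⬝ᵥ v) := by
  have expand (u v : Fin 3 → ℝ) : B u v =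
      ∑ i, ∑ j, u i * v j * B (Pi.single i 1) (Pi.single j 1) := by
    conv_lhs => rw [pi_eq_sum_univ' u, pi_eq_sum_univ' v]
    simp only [map_sum, map_smul, LinearMap.sum_apply, LinearMap.smul_apply, smul_eq_mul,
      Finset.mul_sum, mul_assoc]
    rw [Finset.sum_comm]
    exact Finset.sum_congr rfl fun i _ => Finset.sum_congr rfl fun j _ => mul_left_comm _ _ _
  -- the half-turns about two coordinate axes and the cyclic permutation of the axes
  have h₁ := hB !![1, 0, 0; 0, -1, 0; 0, 0, -1]
    (by ext i j; fin_cases i <;> fin_cases j <;> simp [Matrix.mul_apply, Fin.sum_univ_three])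
    (by simp [Matrix.det_fin_three])
  have h₂ := hB !![-1, 0, 0; 0, -1, 0; 0, 0, 1]
    (by ext i j; fin_cases i <;> fin_cases j <;> simp [Matrix.mul_apply, Fin.sum_univ_three])
    (by simp [Matrix.det_fin_three])
  have h₃ := hB !![0, 0, 1; 1, 0, 0; 0, 1, 0]
    (by ext i j; fin_cases i <;> fin_cases j <;> simp [Matrix.mul_apply, Fin.sum_univ_three])
    (by simp [Matrix.det_fin_three])
  simp only [expand (Matrix.mulVec _ _)] at h₁ h₂ h₃
  have off : ∀ i j : Fin 3, i ≠ j → B (Pi.single i 1) (Pi.single j 1) = 0 := by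
    intro i j hij
    have a₁ := h₁ (Pi.single i 1) (Pi.single j 1)
    have a₂ := h₂ (Pi.single i 1) (Pi.single j 1)
    fin_cases i <;> fin_cases j <;> simp [Fin.sum_univ_three] at hij a₁ a₂ ⊢ <;> linarith
  have d₀ := h₃ (Pi.single 0 1) (Pi.single 0 1)
  have d₁ := h₃ (Pi.single 1 1) (Pi.single 1 1)
  simp [Fin.sum_univ_three] at d₀ d₁
  refine ⟨B (Pi.single 0 1) (Pi.single 0 1), fun u v => ?_⟩
  rw [expand u v]
  simp only [Fin.sum_univ_three, dotProduct, off 0 1 (by decide), off 0 2 (by decide),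
    off 1 0 (by decide), off 1 2 (by decide), off 2 0 (by decide), off 2 1 (by decide), d₁, d₀]
  ring

/-- Every alternating `ℝ`-bilinear form on `ℝ³ × ℝ³` invariant under the
diagonal `SO(3)`-action is a constant multiple of `((q,p),(q',p')) ↦ ⟨q,p'⟩ − ⟨p,q'⟩`. -/
theorem invariant_alternating_form_so3
    (ω : ((Fin 3 → ℝ) × (Fin 3 → ℝ)) →ₗ[ℝ] ((Fin 3 → ℝ) × (Fin 3 → ℝ)) →ₗ[ℝ] ℝ)
    (halt : ∀ x, ω x x = 0)
    (hinv : ∀ g : Matrix (Fin 3) (Fin 3) ℝ, gᵀ * g = 1 → g.det = 1 →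
      ∀ x y : (Fin 3 → ℝ) × (Fin 3 → ℝ),
        ω (g.mulVec x.1, g.mulVec x.2) (g.mulVec y.1, g.mulVec y.2) = ω x y) :
    ∃ c : ℝ, ∀ q p q' p' : Fin 3 → ℝ,
      ω (q, p) (q', p') = c * (q ⬝ᵥ p' - p ⬝ᵥ q') := by
  let ι₁ := LinearMap.inl ℝ (Fin 3 → ℝ) (Fin 3 → ℝ)
  let ι₂ := LinearMap.inr ℝ (Fin 3 → ℝ) (Fin 3 → ℝ)
  obtain ⟨a, ha⟩ := bilinear_eq_smul_dotProduct_of_so3_invariant (ω.compl₁₂ ι₁ ι₁)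
    fun g hg hd u v => by simpa [ι₁] using hinv g hg hd (u, 0) (v, 0)
  obtain ⟨b, hb⟩ := bilinear_eq_smul_dotProduct_of_so3_invariant (ω.compl₁₂ ι₁ ι₂)
    fun g hg hd u v => by simpa [ι₁, ι₂] using hinv g hg hd (u, 0) (0, v)
  obtain ⟨d, hd⟩ := bilinear_eq_smul_dotProduct_of_so3_invariant (ω.compl₁₂ ι₂ ι₂)
    fun g hg hd u v => by simpa [ι₂] using hinv g hg hd (0, u) (0, v)
  simp only [LinearMap.compl₁₂_apply, ι₁, ι₂, LinearMap.inl_apply, LinearMap.inr_apply]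
    at ha hb hd
  have ha₀ : a = 0 := by
    simpa [halt] using (ha (Pi.single 0 1) (Pi.single 0 1)).symm
  have hd₀ : d = 0 := by
    simpa [halt] using (hd (Pi.single 0 1) (Pi.single 0 1)).symm
  have skew (x y) : ω x y = -ω y x := by
    have h := halt (x + y)
    simp only [map_add, LinearMap.add_apply, halt] at h
    linarith
  refine ⟨b, fun q p q' p' => ?_⟩
  have split (u v : Fin 3 → ℝ) : (u, v) = (u, 0) + (0, v) := by simp
  rw [split q p, split q' p']
  simp only [map_add, LinearMap.add_apply]
  rw [skew (0, p) (q', 0), ha, hb, hb, hd, ha₀, hd₀, dotProduct_comm q' p]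
  ring
end

section
/- Let ω be an ℝ-bilinear form on ℂ² (viewed as a real vector space) that is alternating (ω(u,u) = 0 for all u) and invariant under the standard SU(2)-action, i.e. ω(A·u, A·v) = ω(u,v) for all A ∈ SU(2). Then there exist real constants a, b, c such that ω(u,v) = a·Im(conj(u₀)v₀ + conj(u₁)v₁) + b·Re(u₀v₁ − u₁v₀) + c·Im(u₀v₁ − u₁v₀) for all u, v ∈ ℂ². -/
open Matrix

theorem Complex.fin_two_eq_real_combination (u : Fin 2 → ℂ) :
    u = (u 0).re • ![1, 0] + (u 0).im • ![Complex.I, 0]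
      + (u 1).re • ![0, 1] + (u 1).im • ![0, Complex.I] := by
  ext i
  fin_cases i <;> simp [Complex.re_add_im]

theorem of_mulVec_cons_fin_two {R : Type*} [NonUnitalNonAssocSemiring R] (a b c d x y : R) :
    !![a, b; c, d] *ᵥ ![x, y] = ![a * x + b * y, c * x + d * y] := by
  simp

/-- Every alternating `ℝ`-bilinear form on `ℂ²` (as a real vector space)
invariant under the standard `SU(2)`-action is of the form
`ω(u,v) = a·Im(conj(u₀)v₀ + conj(u₁)v₁) + b·Re(u₀v₁ − u₁v₀) + c·Im(u₀v₁ − u₁v₀)`. -/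
theorem invariant_alternating_form_su2
    (ω : (Fin 2 → ℂ) →ₗ[ℝ] (Fin 2 → ℂ) →ₗ[ℝ] ℝ)
    (halt : ∀ u, ω u u = 0)
    (hinv : ∀ A : Matrix (Fin 2) (Fin 2) ℂ, Aᴴ * A = 1 → A.det = 1 →
      ∀ u v : Fin 2 → ℂ, ω (A.mulVec u) (A.mulVec v) = ω u v) :
    ∃ a b c : ℝ, ∀ u v : Fin 2 → ℂ,
      ω u v = a * ((starRingEnd ℂ) (u 0) * v 0 + (starRingEnd ℂ) (u 1) * v 1).im
        + b * (u 0 * v 1 - u 1 * v 0).re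
        + c * (u 0 * v 1 - u 1 * v 0).im := by
  have hskew : ∀ u v, ω v u = -ω u v := by
    intro u v
    have h := halt (u + v)
    simp only [map_add, LinearMap.add_apply, halt] at h
    linarith
  have hrot := hinv !![0, -1; 1, 0]
    (by ext i j; fin_cases i <;> fin_cases j <;> simp [Matrix.mul_apply])
    (by simp [Matrix.det_fin_two])
  have hdiag := hinv !![Complex.I, 0; 0, -Complex.I]
    (by ext i j; fin_cases i <;> fin_cases j <;> simp [Matrix.mul_apply])
    (by simp [Matrix.det_fin_two])
  have h₁ : ω ![0, 1] ![0, Complex.I] = ω ![1, 0] ![Complex.I, 0] := by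
    simpa only [of_mulVec_cons_fin_two, zero_mul, one_mul, mul_zero, mul_one, add_zero]
      using hrot ![1, 0] ![Complex.I, 0]
  have h₂ : ω ![Complex.I, 0] ![0, Complex.I] = -ω ![1, 0] ![0, 1] := by
    have hneg : (![0, -Complex.I] : Fin 2 → ℂ) = -![0, Complex.I] := by simp
    have h := hdiag ![1, 0] ![0, 1]
    simp only [of_mulVec_cons_fin_two, mul_zero, mul_one, add_zero, zero_add] at h
    rw [hneg, map_neg] at h
    linarith
  have h₃ : ω ![Complex.I, 0] ![0, 1] = ω ![1, 0] ![0, Complex.I] := by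
    simpa only [of_mulVec_cons_fin_two, zero_mul, mul_zero, mul_one, add_zero, zero_add, neg_mul,
      Complex.I_mul_I, neg_neg] using hdiag ![1, 0] ![0, Complex.I]
  refine ⟨ω ![1, 0] ![Complex.I, 0], ω ![1, 0] ![0, 1], ω ![1, 0] ![0, Complex.I],
    fun u v ↦ ?_⟩
  conv_lhs =>
    rw [Complex.fin_two_eq_real_combination u, Complex.fin_two_eq_real_combination v]
  simp only [map_add, map_smul, LinearMap.add_apply, LinearMap.smul_apply, smul_eq_mul, halt,
    hskew ![1, 0] ![Complex.I, 0], hskew ![1, 0] ![0, 1], hskew ![1, 0] ![0, Complex.I],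
    hskew ![Complex.I, 0] ![0, 1], hskew ![Complex.I, 0] ![0, Complex.I],
    hskew ![0, 1] ![0, Complex.I], h₁, h₂, h₃, Complex.add_im, Complex.sub_re,
    Complex.sub_im, Complex.mul_re, Complex.mul_im, Complex.conj_re, Complex.conj_im]
  ring
end

section
/- Fix an integer n and let the circle group S¹ act on ℂ × ℂ by a·(w, z) = (a·w, aⁿ·z) for a ∈ S¹. Then the orbit space (ℂ × ℂ)/S¹, equipped with the quotient topology, is contractible. (This is the orbit space of the local model SO(3) ×_{S¹} (ℝ² × ℂ), where S¹ acts on ℝ² by rotation and on ℂ with weight n.) -/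
/-- The quotient of a real topological vector space by an equivalence relation which is stable
under scalar multiplication is contractible: scaling to zero descends to the quotient. -/
theorem Quotient.contractibleSpace_of_smul {E : Type*} [AddCommGroup E] [Module ℝ E]
    [TopologicalSpace E] [ContinuousSMul ℝ E] (s : Setoid E)
    (h : ∀ (c : ℝ) (x y : E), s x y → s (c • x) (c • y)) :
    ContractibleSpace (Quotient s) := by
  rw [contractible_iff_id_nullhomotopic]
  let H : unitInterval × Quotient s → Quotient s := fun p ↦
    Quotient.map' (fun x ↦ (1 - (p.1 : ℝ)) • x) (h _) p.2
  have hH : Continuous H := by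
    refine (isQuotientMap_quotient_mk' (s := s)).continuous_lift_prod_right ?_
    have hc : Continuous fun p : unitInterval × E ↦ (1 - (p.1 : ℝ)) • p.2 := by fun_prop
    exact continuous_quotient_mk'.comp hc
  refine ⟨Quotient.mk s 0, ⟨⟨⟨H, hH⟩, fun q ↦ ?_, fun q ↦ ?_⟩⟩⟩ <;>
    induction q using Quotient.inductionOn <;> simp [H]

/-- For the `S¹`-action on `ℂ × ℂ` given by `a·(w,z) = (a·w, aⁿ·z)`, the orbit
space `(ℂ × ℂ)/S¹` (with the quotient topology) is contractible. -/
theorem quotient_C2_by_circle_weight_action_contractible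
    (n : ℤ) (s : Setoid (ℂ × ℂ))
    (hs : ∀ x y, s.r x y ↔
      ∃ a : ℂ, ‖a‖ = 1 ∧ a * x.1 = y.1 ∧ a ^ n * x.2 = y.2) :
    ContractibleSpace (Quotient s) := by
  refine Quotient.contractibleSpace_of_smul s fun c x y hxy ↦ ?_
  obtain ⟨a, ha, h₁, h₂⟩ := (hs x y).mp hxy
  exact (hs _ _).mpr ⟨a, ha, by simp [← h₁, mul_left_comm], by simp [← h₂, mul_left_comm]⟩
end

section
/- Let the orthogonal group O(2) act on ℝ² × ℂ by A·(μ, z) = (A·μ, det(A)·z), where A acts on ℝ² by matrix–vector multiplication and multiplies z ∈ ℂ by det(A) = ±1. Then the map (μ, z) ↦ (|μ|², z²) is constant on O(2)-orbits and induces a homeomorphism from the orbit space (ℝ² × ℂ)/O(2), with the quotient topology, onto [0,∞) × ℂ. (This is the trivializing homeomorphism for the local model SO(3) ×_{N(S¹)} (ℝ² × ℂ).) -/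
open Matrix

/-- Two vectors of the plane of equal Euclidean length are related by an orthogonal matrix of any
prescribed determinant `ε = ±1`. -/
lemma exists_orthogonal_mulVec_eq_of_det (u v : Fin 2 → ℝ) (huv : u ⬝ᵥ u = v ⬝ᵥ v)
    {ε : ℝ} (hε : ε ^ 2 = 1) :
    ∃ A : Matrix (Fin 2) (Fin 2) ℝ, Aᵀ * A = 1 ∧ A.mulVec u = v ∧ A.det = ε := by
  simp only [dotProduct, Fin.sum_univ_two] at huv
  obtain ⟨a, b, hab, h₀, h₁⟩ : ∃ a b : ℝ, a ^ 2 + b ^ 2 = 1 ∧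
      a * u 0 - ε * b * u 1 = v 0 ∧ b * u 0 + ε * a * u 1 = v 1 := by
    by_cases hr : u 0 * u 0 + u 1 * u 1 = 0
    · have hu₀ : u 0 = 0 := by nlinarith [mul_self_nonneg (u 0), mul_self_nonneg (u 1)]
      have hu₁ : u 1 = 0 := by nlinarith [mul_self_nonneg (u 0), mul_self_nonneg (u 1)]
      have hv₀ : v 0 = 0 := by nlinarith [mul_self_nonneg (v 0), mul_self_nonneg (v 1)]
      have hv₁ : v 1 = 0 := by nlinarith [mul_self_nonneg (v 0), mul_self_nonneg (v 1)]
      exact ⟨1, 0, by simp, by simp [hu₀, hu₁, hv₀], by simp [hu₀, hu₁, hv₁]⟩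
    · refine ⟨(u 0 * v 0 + ε * u 1 * v 1) / (u 0 * u 0 + u 1 * u 1),
        (u 0 * v 1 - ε * u 1 * v 0) / (u 0 * u 0 + u 1 * u 1), ?_, ?_, ?_⟩
      · rw [div_pow, div_pow, ← add_div, div_eq_one_iff_eq (pow_ne_zero 2 hr)]
        linear_combination (u 1 ^ 2 * (v 0 ^ 2 + v 1 ^ 2)) * hε
          - (u 0 * u 0 + u 1 * u 1) * huv
      · linear_combination (u 1 ^ 2 * v 0 / (u 0 * u 0 + u 1 * u 1)) * hε
          + v 0 * mul_inv_cancel₀ hr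
      · linear_combination (u 1 ^ 2 * v 1 / (u 0 * u 0 + u 1 * u 1)) * hε
          + v 1 * mul_inv_cancel₀ hr
  refine ⟨!![a, -(ε * b); b, ε * a], ?_, ?_, ?_⟩
  · ext i j
    fin_cases i <;> fin_cases j <;> simp [Matrix.mul_apply, Fin.sum_univ_two]
    · linear_combination hab
    · ring
    · ring
    · linear_combination ε ^ 2 * hab + hε
  · ext i
    fin_cases i <;> simp [Matrix.mulVec, dotProduct, Fin.sum_univ_two]
    · linear_combination h₀
    · linear_combination h₁
  · rw [Matrix.det_fin_two_of]
    linear_combination ε * hab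

/-- The squared Euclidean length is a proper function. -/
lemma isProperMap_dotProduct_self {ι : Type*} [Fintype ι] :
    IsProperMap fun u : ι → ℝ ↦ u ⬝ᵥ u := by
  have hcont : Continuous fun u : ι → ℝ ↦ u ⬝ᵥ u := by fun_prop
  refine isProperMap_iff_tendsto_cocompact.2 ⟨hcont, ?_⟩
  have hle (u : ι → ℝ) : ‖u‖ ^ 2 ≤ u ⬝ᵥ u := by
    have h₀ : 0 ≤ u ⬝ᵥ u := Finset.sum_nonneg fun i _ ↦ mul_self_nonneg (u i)
    refine (Real.le_sqrt (norm_nonneg u) h₀).1 ((pi_norm_le_iff_of_nonneg (Real.sqrt_nonneg _)).2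
      fun i ↦ Real.abs_le_sqrt ?_)
    rw [pow_two]
    exact Finset.single_le_sum (f := fun i ↦ u i * u i) (fun i _ ↦ mul_self_nonneg (u i))
      (Finset.mem_univ i)
  refine Filter.Tendsto.mono_right (Filter.tendsto_atTop_mono hle ?_) atTop_le_cocompact
  exact (Filter.tendsto_pow_atTop two_ne_zero).comp (tendsto_norm_cocompact_atTop (E := ι → ℝ))

/-- Positive powers are proper functions on a proper normed field. -/
lemma isProperMap_pow {𝕜 : Type*} [NormedField 𝕜] [ProperSpace 𝕜] {n : ℕ} (hn : n ≠ 0) :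
    IsProperMap fun z : 𝕜 ↦ z ^ n := by
  refine isProperMap_iff_tendsto_cocompact.2 ⟨continuous_pow n, ?_⟩
  rw [← Metric.cobounded_eq_cocompact, ← tendsto_norm_atTop_iff_cobounded]
  simp only [norm_pow]
  exact (Filter.tendsto_pow_atTop hn).comp tendsto_norm_cobounded_atTop

/-- The map `(μ, z) ↦ (|μ|², z²)` with values in `[0,∞) × ℂ`. -/
def sqLengthSqMap : C((Fin 2 → ℝ) × ℂ, {p : ℝ × ℂ | 0 ≤ p.1}) where
  toFun x := ⟨(x.1 ⬝ᵥ x.1, x.2 ^ 2), by simpa using dotProduct_star_self_nonneg x.1⟩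
  continuous_toFun := by fun_prop

lemma surjective_sqLengthSqMap : Function.Surjective sqLengthSqMap := by
  rintro ⟨⟨r, w⟩, hr⟩
  obtain ⟨z, rfl⟩ := IsSquare.exists_sq w (IsAlgClosed.exists_eq_mul_self w)
  exact ⟨(![√r, 0], z), Subtype.ext (by simp [sqLengthSqMap, Real.mul_self_sqrt hr])⟩

lemma isQuotientMap_sqLengthSqMap : Topology.IsQuotientMap sqLengthSqMap := by
  have hF : IsProperMap fun x : (Fin 2 → ℝ) × ℂ ↦ (x.1 ⬝ᵥ x.1, x.2 ^ 2) :=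
    (isProperMap_dotProduct_self (ι := Fin 2)).prodMap (isProperMap_pow (𝕜 := ℂ) two_ne_zero)
  exact (isProperMap_of_comp_of_inj sqLengthSqMap.continuous continuous_subtype_val hF
    Subtype.val_injective).isClosedMap.isQuotientMap sqLengthSqMap.continuous
      surjective_sqLengthSqMap

/-- The fibres of `sqLengthSqMap` are the `O(2)`-orbits. -/
lemma sqLengthSqMap_eq_iff (x y : (Fin 2 → ℝ) × ℂ) :
    sqLengthSqMap x = sqLengthSqMap y ↔ ∃ A : Matrix (Fin 2) (Fin 2) ℝ,
      Aᵀ * A = 1 ∧ A.mulVec x.1 = y.1 ∧ (A.det : ℂ) * x.2 = y.2 := by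
  simp only [sqLengthSqMap, ContinuousMap.coe_mk, Subtype.mk.injEq, Prod.mk.injEq]
  constructor
  · rintro ⟨h₁, h₂⟩
    obtain ⟨ε, hε, hz⟩ : ∃ ε : ℝ, ε ^ 2 = 1 ∧ (ε : ℂ) * x.2 = y.2 := by
      rcases sq_eq_sq_iff_eq_or_eq_neg.1 h₂ with h | h
      · exact ⟨1, by simp, by simp [h]⟩
      · exact ⟨-1, by simp, by simp [h]⟩
    obtain ⟨A, hA, hAx, rfl⟩ := exists_orthogonal_mulVec_eq_of_det x.1 y.1 h₁ hε
    exact ⟨A, hA, hAx, hz⟩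
  · rintro ⟨A, hA, hAx, hz⟩
    have hdet : A.det ^ 2 = 1 := by
      simpa [pow_two] using congrArg Matrix.det hA
    constructor
    · rw [← hAx, Matrix.dotProduct_mulVec, Matrix.vecMul_mulVec, hA, Matrix.vecMul_one]
    · rw [← hz, mul_pow, ← Complex.ofReal_pow, hdet, Complex.ofReal_one, one_mul]

/-- For the `O(2)`-action on `ℝ² × ℂ` given by `A·(μ,z) = (A·μ, det(A)·z)`,
the map `(μ,z) ↦ (|μ|², z²)` is constant on orbits and induces a homeomorphism from the
orbit space (with the quotient topology) onto `[0,∞) × ℂ`. -/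
theorem quotient_O2_trivializing_homeomorph
    (s : Setoid ((Fin 2 → ℝ) × ℂ))
    (hs : ∀ x y, s.r x y ↔ ∃ A : Matrix (Fin 2) (Fin 2) ℝ,
      Aᵀ * A = 1 ∧ A.mulVec x.1 = y.1 ∧ (A.det : ℂ) * x.2 = y.2) :
    (∀ x y, s.r x y →
      ((x.1 ⬝ᵥ x.1 : ℝ), x.2 ^ 2) = ((y.1 ⬝ᵥ y.1 : ℝ), y.2 ^ 2)) ∧
    ∃ h : Quotient s ≃ₜ {p : ℝ × ℂ | 0 ≤ p.1},
      ∀ x : (Fin 2 → ℝ) × ℂ,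
        (h (Quotient.mk s x) : ℝ × ℂ) = ((x.1 ⬝ᵥ x.1 : ℝ), x.2 ^ 2) := by
  obtain rfl : s = Setoid.ker sqLengthSqMap :=
    Setoid.ext fun x y ↦ (hs x y).trans (sqLengthSqMap_eq_iff x y).symm
  exact ⟨fun x y h ↦ congrArg Subtype.val h,
    isQuotientMap_sqLengthSqMap.homeomorph, fun _ ↦ rfl⟩
end
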